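/- For x : ℕ∞ define fₓ gₓ : Bool × ℕ∞ → Bool × ℕ∞ by: fₓ (false, y) = (false, y + 1); fₓ (true, 0) = (false, 0); fₓ (true, y + 1) = (true, y) if 2y + 1 < x and fₓ (true, y + 1) = (true, y + 1) otherwise (with the conventions ⊤ = ⊤ + 1 and 2⊤ + 1 = ⊤, so fₓ (true, ⊤) = (true, ⊤)); gₓ (false, y) = (false, y); gₓ (true, y) = (true, y) if 2y < x and gₓ (true, y) = (true, y + 1) otherwise. Then there do NOT exist continuous functions H H' : ℕ∞ × (Bool × ℕ∞) → Bool × ℕ∞ such that for every x : ℕ∞: (i) H (x, ·) and H' (x, ·) are mutually inverse bijections of Bool × ℕ∞, and (ii) for every z : Bool × ℕ∞, either there exists k : ℕ with H (x, z) = fₓ ((gₓ ∘ fₓ)^[k] z), or there exists k : ℕ with z = (gₓ ∘ fₓ)^[k] (gₓ (H (x, z))). In other words, a bijection generated by (fₓ, gₓ) together with its inverse cannot be produced continuously (uniformly) in the parameter x. -/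

import Mathlib

/-- The family of injections `fₓ`: `fₓ (false, y) = (false, y + 1)`,
`fₓ (true, 0) = (false, 0)`, and `fₓ (true, y + 1) = (true, y)` if `2y + 1 < x`
and `(true, y + 1)` otherwise (so `fₓ (true, ⊤) = (true, ⊤)`). -/
def fX (x : ℕ∞) : Bool × ℕ∞ → Bool × ℕ∞
  | (false, y) => (false, y + 1)
  | (true, y) =>
      if y = 0 then (false, 0)
      else if 2 * (y - 1) + 1 < x then (true, y - 1) else (true, y)

/-- The family of injections `gₓ`: `gₓ (false, y) = (false, y)`, and
`gₓ (true, y) = (true, y)` if `2y < x` and `(true, y + 1)` otherwise. -/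
def gX (x : ℕ∞) : Bool × ℕ∞ → Bool × ℕ∞
  | (false, y) => (false, y)
  | (true, y) => if 2 * y < x then (true, y) else (true, y + 1)

open Set Filter Topology

/-- If a bijection `h` carries `X ∪ F` onto `Y ∪ F`, with `X` and `Y` finite and disjoint from `F`,
then the net number of points it moves into `F` is `#X - #Y`. -/
lemma ncard_add_ncard_eq_of_mapsTo_iff {α : Type*} {h : α → α} (hh : h.Bijective)
    {F X Y : Set α} (hX : X.Finite) (hY : Y.Finite) (hXF : Disjoint X F) (hYF : Disjoint Y F)
    (hiff : ∀ z, h z ∈ Y ∪ F ↔ z ∈ X ∪ F) :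
    X.ncard + (F ∩ h ⁻¹' Fᶜ).ncard = (Fᶜ ∩ h ⁻¹' F).ncard + Y.ncard := by
  rw [disjoint_left] at hXF hYF
  have hpre : (h ⁻¹' Y).Finite := hY.preimage hh.injective.injOn
  have hcard : (h ⁻¹' Y).ncard = Y.ncard :=
    ncard_preimage_of_injective_subset_range hh.injective (by simp [hh.surjective.range_eq])
  have hS : Fᶜ ∩ h ⁻¹' F = X \ h ⁻¹' Y := by
    ext z
    have := hiff z
    have := @hXF z
    have := @hYF (h z)
    simp only [mem_union, mem_inter_iff, mem_compl_iff, mem_preimage, Set.mem_sdiff] at *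
    tauto
  have hT : F ∩ h ⁻¹' Fᶜ = h ⁻¹' Y \ X := by
    ext z
    have := hiff z
    have := @hXF z
    have := @hYF (h z)
    simp only [mem_union, mem_inter_iff, mem_compl_iff, mem_preimage, Set.mem_sdiff] at *
    tauto
  rw [hS, hT, ← hcard, ncard_sdiff_add_ncard _ _ hX hpre, add_comm,
    ncard_sdiff_add_ncard _ _ hpre hX, union_comm]

/-- The points `(true, n)` with `n < k`. -/
def trueBelow (k : ℕ) : Set (Bool × ℕ∞) :=
  (fun n : ℕ => (true, (n : ℕ∞))) '' Iio k

lemma finite_trueBelow (k : ℕ) : (trueBelow k).Finite :=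
  (finite_Iio k).image _

lemma ncard_trueBelow (k : ℕ) : (trueBelow k).ncard = k := by
  rw [trueBelow, ncard_image_of_injective _ fun a b hab => by simpa using hab]
  simp [← Finset.coe_Iio, ncard_coe_finset]

lemma disjoint_trueBelow (k : ℕ) : Disjoint (trueBelow k) {z | z.1 = false} := by
  rw [disjoint_left]
  rintro _ ⟨n, -, rfl⟩
  simp

lemma coe_mem_trueBelow {k n : ℕ} : (true, (n : ℕ∞)) ∈ trueBelow k ↔ n < k := by
  simp [trueBelow]

lemma top_notMem_trueBelow {k : ℕ} : (true, (⊤ : ℕ∞)) ∉ trueBelow k := by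
  simp [trueBelow]

/-- The domain side of the component of `(false, 0)` in the graph of `(fX m, gX m)`. -/
def domComponent (m : ℕ) : Set (Bool × ℕ∞) := trueBelow (m / 2 + 1) ∪ {z | z.1 = false}

/-- The codomain side of the component of `(false, 0)` in the graph of `(fX m, gX m)`. -/
def codComponent (m : ℕ) : Set (Bool × ℕ∞) := trueBelow ((m + 1) / 2) ∪ {z | z.1 = false}

lemma fX_mem_codComponent (m : ℕ) (z : Bool × ℕ∞) :
    fX m z ∈ codComponent m ↔ z ∈ domComponent m := by
  obtain ⟨_ | _, y⟩ := z
  · simp [fX, codComponent, domComponent]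
  induction y with
  | top => simp [fX, codComponent, domComponent, top_notMem_trueBelow]
  | coe n =>
    cases n with
    | zero => simp [fX, codComponent, domComponent, ← Nat.cast_zero (R := ℕ∞), coe_mem_trueBelow,
        -Nat.cast_zero, -CharP.cast_eq_zero]
    | succ n =>
      have hsub : ((n + 1 : ℕ) : ℕ∞) - 1 = n := by norm_cast
      have hlt : 2 * (n : ℕ∞) + 1 < m ↔ 2 * n + 1 < m := by norm_cast
      have hne : ((n + 1 : ℕ) : ℕ∞) ≠ 0 := by norm_cast
      simp only [fX, hne, if_false, hsub, hlt]
      split_ifs <;> simp only [codComponent, domComponent, mem_union, coe_mem_trueBelow,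
        mem_ofPred_eq, Bool.true_eq_false, or_false] <;> omega

lemma gX_mem_domComponent (m : ℕ) (z : Bool × ℕ∞) :
    gX m z ∈ domComponent m ↔ z ∈ codComponent m := by
  obtain ⟨_ | _, y⟩ := z
  · simp [gX, codComponent, domComponent]
  induction y with
  | top => simp [gX, codComponent, domComponent, top_notMem_trueBelow]
  | coe n =>
    have hlt : 2 * (n : ℕ∞) < m ↔ 2 * n < m := by norm_cast
    have hadd : (n : ℕ∞) + 1 = (n + 1 : ℕ) := by norm_cast
    simp only [gX, hlt, hadd]
    split_ifs <;> simp only [codComponent, domComponent, mem_union, coe_mem_trueBelow,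
      mem_ofPred_eq, Bool.true_eq_false, or_false] <;> omega

lemma iterate_mem_domComponent (m k : ℕ) (z : Bool × ℕ∞) :
    (gX m ∘ fX m)^[k] z ∈ domComponent m ↔ z ∈ domComponent m := by
  induction k with
  | zero => rfl
  | succ k ih =>
    rw [Function.iterate_succ_apply', Function.comp_apply, gX_mem_domComponent,
      fX_mem_codComponent, ih]

/-- For a bijection generated by `(fX m, gX m)`, the net number of points moved from
`{true} × ℕ∞` to `{false} × ℕ∞` is `1` when `m` is even and `0` when `m` is odd. -/
lemma ncard_flow_of_generated (m : ℕ) {h : Bool × ℕ∞ → Bool × ℕ∞} (hh : h.Bijective)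
    (hgen : ∀ z, (∃ k : ℕ, h z = fX m ((gX m ∘ fX m)^[k] z)) ∨
      (∃ k : ℕ, z = (gX m ∘ fX m)^[k] (gX m (h z)))) :
    m / 2 + 1 + {z | z.1 = false ∧ (h z).1 ≠ false}.ncard =
      {z | z.1 ≠ false ∧ (h z).1 = false}.ncard + (m + 1) / 2 := by
  have hiff (z) : h z ∈ codComponent m ↔ z ∈ domComponent m := by
    obtain ⟨k, hk⟩ | ⟨k, hk⟩ := hgen z
    · rw [hk, fX_mem_codComponent, iterate_mem_domComponent]
    · conv_rhs => rw [hk]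
      rw [iterate_mem_domComponent, gX_mem_domComponent]
  have := ncard_add_ncard_eq_of_mapsTo_iff hh (finite_trueBelow _) (finite_trueBelow _)
    (disjoint_trueBelow _) (disjoint_trueBelow _) hiff
  rwa [ncard_trueBelow, ncard_trueBelow] at this

/-- No pair of continuous functions can, uniformly in the parameter `x`,
produce a bijection generated by `(fₓ, gₓ)` together with its inverse. -/
theorem no_continuous_uniform_myhill :
    ¬ ∃ H H' : ℕ∞ × (Bool × ℕ∞) → Bool × ℕ∞,
      Continuous H ∧ Continuous H' ∧
      ∀ x : ℕ∞,
        (∀ z : Bool × ℕ∞, H' (x, H (x, z)) = z) ∧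
        (∀ z : Bool × ℕ∞, H (x, H' (x, z)) = z) ∧
        (∀ z : Bool × ℕ∞,
          (∃ k : ℕ, H (x, z) = fX x ((gX x ∘ fX x)^[k] z)) ∨
          (∃ k : ℕ, z = (gX x ∘ fX x)^[k] (gX x (H (x, z))))) := by
  rintro ⟨H, H', hH, -, hgen⟩
  have hloc : ∀ᶠ x in 𝓝 (⊤ : ℕ∞), ∀ z ∈ (univ : Set (Bool × ℕ∞)),
      (H (x, z)).1 = (H (⊤, z)).1 := by
    refine isCompact_univ.eventually_forall_of_forall_eventually fun z _ => ?_
    have hc : Continuous fun p : ℕ∞ × (Bool × ℕ∞) => ((H p).1, (H (⊤, p.2)).1) := by fun_prop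
    exact ((isOpen_discrete {b : Bool × Bool | b.1 = b.2}).preimage hc).mem_nhds
      (show (H (⊤, z)).1 = (H (⊤, z)).1 from rfl)
  obtain ⟨M, hM⟩ := eventually_atTop.1 (ENat.tendsto_natCast_nhds_top.eventually hloc)
  have hflow (m : ℕ) (hm : M ≤ m) := ncard_flow_of_generated m (h := fun z => H (m, z))
    (Function.bijective_iff_has_inverse.2
      ⟨fun z => H' (m, z), (hgen m).1, (hgen m).2.1⟩)
    (hgen m).2.2
  have heven := hflow (2 * M) (by omega)
  have hodd := hflow (2 * M + 1) (by omega)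
  simp only [hM (2 * M) (by omega) _ (mem_univ _)] at heven
  simp only [hM (2 * M + 1) (by omega) _ (mem_univ _)] at hodd
  omega
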